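/- (Lemma 3, approximation of step functions by double Walsh polynomials) For any ε > 0, any integer N > 1, and any step function f(x,y) = ∑_{ν=1}^{ν_0} γ_ν χ_{Δ_ν}(x,y) with dyadic rectangles Δ_ν ⊆ T = [0,1]^2, there exist a measurable set E ⊆ T and a double Walsh polynomial P(x,y) = ∑_{k,s=N}^M c_{k,s}W_k(x)W_s(y) such that: (I) P = f on E; (II) |E| > 1 − ε; (III) ∑_{k,s=N}^M |c_{k,s}|^{2+ε} < ε; and (IV) for every measurable subset e ⊆ E, the maximum over rectangular partial sums N ≤ n̄, m̄ < M of ∫∫_e |∑_{k,s=N}^{n̄,m̄} c_{k,s}W_k(x)W_s(y)| dxdy plus the maximum over √2·N ≤ R ≤ √2·M of the corresponding spherical partial-sum integrals ∫∫_e |∑_{2N² ≤ k²+s² ≤ R²} c_{k,s}W_k(x)W_s(y)| dxdy is at most 2·∫∫_e |f(x,y)| dxdy + ε. -/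

import Mathlib

open MeasureTheory Real
open scoped ENNReal Classical

/-- The basic Rademacher function: 1-periodic, equal to `1` on `[0,1/2)` and `-1` on `[1/2,1)`. -/
noncomputable def rad0 (x : ℝ) : ℝ := if Int.fract x < 1/2 then 1 else -1

/-- The Rademacher functions `r_k(x) = r_0(2^k x)`. -/
noncomputable def rad (k : ℕ) (x : ℝ) : ℝ := rad0 (2 ^ k * x)

/-- The Walsh–Paley functions: `W_n = ∏ r_m` over the binary digits `m` of `n`. -/
noncomputable def walsh (n : ℕ) (x : ℝ) : ℝ :=
  ∏ m ∈ Finset.range (n + 1), if n.testBit m then rad m x else 1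

/-- The unit square `T = [0,1]²`. -/
def T : Set (ℝ × ℝ) := Set.Icc (0:ℝ) 1 ×ˢ Set.Icc (0:ℝ) 1

lemma walsh_zero' (x : ℝ) : walsh 0 x = 1 := by simp [walsh]

lemma walsh_ext (n B : ℕ) (h : n < B) (x : ℝ) :
    walsh n x = ∏ m ∈ Finset.range B, if n.testBit m then rad m x else 1 := by
  unfold walsh
  apply Finset.prod_subset
  · intro i hi; simp at hi ⊢; omega
  · intro i _ hi
    have : n < 2 ^ i := by
      simp at hi
      exact lt_of_lt_of_le (by omega) (Nat.lt_two_pow_self (n := i)).le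
    simp [Nat.testBit_lt_two_pow this]

lemma walsh_rec (n : ℕ) (x : ℝ) :
    walsh n x = (if n % 2 = 1 then rad0 x else 1) * walsh (n / 2) (2 * x) := by
  rw [walsh_ext n (n + 2) (by omega), walsh_ext (n / 2) (n + 1) (by omega),
    Finset.prod_range_succ', mul_comm]
  congr 1
  · simp [rad, Nat.testBit_zero]
  · apply Finset.prod_congr rfl
    intro i _
    rw [Nat.testBit_succ]
    simp [rad, pow_succ, mul_assoc]

lemma rad0_sq (x : ℝ) : rad0 x * rad0 x = 1 := by
  unfold rad0; split_ifs <;> norm_num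

lemma walsh_mul_self (n : ℕ) (x : ℝ) : walsh n x * walsh n x = 1 := by
  unfold walsh
  rw [← Finset.prod_mul_distrib]
  apply Finset.prod_eq_one
  intro i _
  split_ifs
  · exact rad0_sq _
  · norm_num

lemma abs_walsh (n : ℕ) (x : ℝ) : |walsh n x| = 1 := by
  have := walsh_mul_self n x
  rw [← abs_mul_abs_self] at this
  nlinarith [abs_nonneg (walsh n x)]

lemma walsh_add (L k j : ℕ) (x : ℝ) (hk : k < 2 ^ L) :
    walsh (k + j * 2 ^ L) x = walsh k x * walsh j (2 ^ L * x) := by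
  induction L generalizing k x with
  | zero =>
    have : k = 0 := by simpa using hk
    subst this; simp [walsh_zero']
  | succ L ih =>
    rw [walsh_rec, walsh_rec k]
    have h1 : (k + j * 2 ^ (L + 1)) % 2 = k % 2 := by
      rw [pow_succ, ← mul_assoc]; omega
    have h2 : (k + j * 2 ^ (L + 1)) / 2 = k / 2 + j * 2 ^ L := by
      rw [pow_succ, ← mul_assoc]; omega
    rw [h1, h2, ih (k / 2) (2 * x) (by rw [pow_succ] at hk; omega)]
    rw [pow_succ]; ring_nf

lemma measurable_rad0 : Measurable rad0 := by
  unfold rad0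
  exact Measurable.ite (measurableSet_lt measurable_fract measurable_const)
    measurable_const measurable_const

lemma measurable_walsh (n : ℕ) : Measurable (walsh n) := by
  unfold walsh
  refine Finset.measurable_prod _ fun m _ => ?_
  split_ifs
  · exact measurable_rad0.comp (measurable_const.mul measurable_id)
  · exact measurable_const

/-- Sum over `range (2^(n+1))` split by parity. -/
lemma sum_range_two_mul (F : ℕ → ℝ) (n : ℕ) :
    ∑ k ∈ Finset.range (2 * n), F k = ∑ k ∈ Finset.range n, (F (2 * k) + F (2 * k + 1)) := by
  induction n with
  | zero => simp
  | succ n ih =>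
    rw [Finset.sum_range_succ, ← ih, show 2 * (n + 1) = 2 * n + 1 + 1 by ring,
      Finset.sum_range_succ, Finset.sum_range_succ]; ring

lemma fract_two_mul (x : ℝ) :
    Int.fract (2 * x) = 2 * Int.fract x - (if Int.fract x < 1 / 2 then 0 else 1) := by
  have h0 := Int.fract_nonneg x
  have h1 := Int.fract_lt_one x
  rw [Int.fract_eq_iff]
  split_ifs with h
  · refine ⟨by linarith, by linarith, 2 * ⌊x⌋, ?_⟩
    have := Int.self_sub_floor x
    push_cast; linarith
  · push Not at h
    refine ⟨by linarith, by linarith, 2 * ⌊x⌋ + 1, ?_⟩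
    have := Int.self_sub_floor x
    push_cast; linarith

lemma kernel_floor (m : ℕ) (x : ℝ) :
    ⌊(2:ℝ) ^ (m + 1) * Int.fract x⌋ =
      ⌊(2:ℝ) ^ m * Int.fract (2 * x)⌋ + (if Int.fract x < 1 / 2 then 0 else 2 ^ m) := by
  rw [fract_two_mul]
  split_ifs with h
  · rw [pow_succ]; simp [mul_assoc]
  · rw [show ((2:ℤ) ^ m) = ((2 ^ m : ℕ) : ℤ) by push_cast; rfl, ← Int.floor_add_natCast]
    congr 1; push_cast; ring

lemma floor_bd (m : ℕ) (x : ℝ) :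
    0 ≤ ⌊(2:ℝ) ^ m * Int.fract x⌋ ∧ ⌊(2:ℝ) ^ m * Int.fract x⌋ < 2 ^ m := by
  have h0 := Int.fract_nonneg x
  have h1 := Int.fract_lt_one x
  have hp : (0:ℝ) < 2 ^ m := by positivity
  refine ⟨Int.floor_nonneg.2 (by positivity), Int.floor_lt.2 ?_⟩
  push_cast; nlinarith

lemma kernel (m : ℕ) (x y : ℝ) :
    ∑ k ∈ Finset.range (2 ^ m), walsh k x * walsh k y =
      if ⌊(2:ℝ) ^ m * Int.fract x⌋ = ⌊(2:ℝ) ^ m * Int.fract y⌋ then 2 ^ m else 0 := by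
  induction m generalizing x y with
  | zero =>
    have hx := floor_bd 0 x
    have hy := floor_bd 0 y
    rw [if_pos (by omega)]
    simp [walsh_zero']
  | succ m ih =>
    rw [pow_succ, mul_comm, sum_range_two_mul]
    have : ∀ k ∈ Finset.range (2 ^ m), (walsh (2 * k) x * walsh (2 * k) y +
        walsh (2 * k + 1) x * walsh (2 * k + 1) y) =
        (1 + rad0 x * rad0 y) * (walsh k (2 * x) * walsh k (2 * y)) := by
      intro k _
      rw [walsh_rec (2 * k) x, walsh_rec (2 * k) y, walsh_rec (2 * k + 1) x,
        walsh_rec (2 * k + 1) y]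
      have e1 : (2 * k) % 2 = 0 := by omega
      have e2 : (2 * k + 1) % 2 = 1 := by omega
      have e3 : (2 * k) / 2 = k := by omega
      have e4 : (2 * k + 1) / 2 = k := by omega
      rw [e1, e2, e3, e4]; simp; ring
    rw [Finset.sum_congr rfl this, ← Finset.mul_sum, ih, kernel_floor, kernel_floor]
    have hx := floor_bd m (2 * x)
    have hy := floor_bd m (2 * y)
    unfold rad0
    generalize ⌊(2:ℝ) ^ m * Int.fract (2 * x)⌋ = A at *
    generalize ⌊(2:ℝ) ^ m * Int.fract (2 * y)⌋ = B at *
    split_ifs <;> first | (exfalso; omega) | (rw [pow_succ]; ring) | norm_num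

lemma kernel_zero (q : ℕ) (x : ℝ) :
    ∑ j ∈ Finset.range (2 ^ q), walsh j x =
      if Int.fract x < (2 ^ q)⁻¹ then 2 ^ q else 0 := by
  have h := kernel q x 0
  have w0 : ∀ j, walsh j 0 = 1 := by
    intro j; simp [walsh, rad, rad0]
  simp only [w0, mul_one] at h
  rw [h]
  have hp : (0:ℝ) < 2 ^ q := by positivity
  congr 1
  simp only [Int.fract_zero, mul_zero, Int.floor_zero, eq_iff_iff]
  rw [Int.floor_eq_iff, ← one_div, lt_div_iff₀ hp]
  have := Int.fract_nonneg x
  constructor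
  · rintro ⟨_, h2⟩; push_cast at h2; linarith
  · intro h2; exact ⟨by push_cast; positivity, by push_cast; linarith⟩

lemma walsh_add_one (n : ℕ) (x : ℝ) : walsh n (x + 1) = walsh n x := by
  unfold walsh
  refine Finset.prod_congr rfl fun m _ => ?_
  have : rad m (x + 1) = rad m x := by
    unfold rad rad0
    rw [mul_add, mul_one, show ((2:ℝ) ^ m) = ((2 ^ m : ℕ) : ℝ) by push_cast; rfl,
      Int.fract_add_natCast]
  rw [this]

lemma rad0_add_half (x : ℝ) : rad0 (x + 1 / 2) = - rad0 x := by
  have h0 := Int.fract_nonneg x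
  have h1 := Int.fract_lt_one x
  have hx := Int.self_sub_floor x
  unfold rad0
  by_cases h : Int.fract x < 1 / 2
  · have : Int.fract (x + 1 / 2) = Int.fract x + 1 / 2 := by
      rw [Int.fract_eq_iff]
      exact ⟨by linarith, by linarith, ⌊x⌋, by linarith⟩
    rw [if_pos h, if_neg (by linarith)]
  · have : Int.fract (x + 1 / 2) = Int.fract x - 1 / 2 := by
      push Not at h
      rw [Int.fract_eq_iff]
      exact ⟨by linarith, by linarith, ⌊x⌋ + 1, by push_cast; linarith⟩
    rw [if_neg h, if_pos (by linarith)]; norm_num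

lemma walsh_mul_intervalIntegrable (n m : ℕ) (a b : ℝ) :
    IntervalIntegrable (fun x => walsh n x * walsh m x) volume a b := by
  refine (intervalIntegrable_const (c := (1:ℝ))).mono_fun
    ((measurable_walsh n).mul (measurable_walsh m)).aestronglyMeasurable ?_
  filter_upwards with x
  simp [abs_walsh]

lemma orth_interval (n m : ℕ) (h : n ≠ m) :
    ∫ x in (0:ℝ)..1, walsh n x * walsh m x = 0 := by
  induction hs : n + m using Nat.strong_induction_on generalizing n m with
  | _ s ih =>
  by_cases hp : n % 2 = m % 2
  · have hne : n / 2 ≠ m / 2 := by omega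
    have e : ∀ x, walsh n x * walsh m x = walsh (n / 2) (2 * x) * walsh (m / 2) (2 * x) := by
      intro x
      rw [walsh_rec n, walsh_rec m, hp]
      split_ifs
      · have := rad0_sq x
        linear_combination (walsh (n / 2) (2 * x) * walsh (m / 2) (2 * x)) * this
      · ring
    simp_rw [e]
    rw [intervalIntegral.integral_comp_mul_left (fun y => walsh (n / 2) y * walsh (m / 2) y)
      (by norm_num : (2:ℝ) ≠ 0)]
    have i1 := ih (n / 2 + m / 2) (by omega) (n / 2) (m / 2) hne rfl
    have i2 : ∫ x in (1:ℝ)..2, walsh (n / 2) x * walsh (m / 2) x = 0 := by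
      have := intervalIntegral.integral_comp_add_right (a := 0) (b := 1)
        (fun y => walsh (n / 2) y * walsh (m / 2) y) 1
      simp only [walsh_add_one] at this
      norm_num at this
      rw [← this, i1]
    rw [← intervalIntegral.integral_add_adjacent_intervals
      (walsh_mul_intervalIntegrable _ _ (2 * 0) 1) (walsh_mul_intervalIntegrable _ _ 1 (2 * 1))]
    norm_num [i1, i2]
  · have e : ∀ x, walsh n (x + 1 / 2) * walsh m (x + 1 / 2) = -(walsh n x * walsh m x) := by
      intro x
      rw [walsh_rec n, walsh_rec m, walsh_rec n x, walsh_rec m x, rad0_add_half,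
        show 2 * (x + 1 / 2) = 2 * x + 1 by ring, walsh_add_one, walsh_add_one]
      split_ifs
      · omega
      · ring
      · ring
      · omega
    have := intervalIntegral.integral_comp_add_right (a := 0) (b := 1 / 2)
        (fun y => walsh n y * walsh m y) (1 / 2)
    simp only [e] at this
    rw [intervalIntegral.integral_neg] at this
    rw [← intervalIntegral.integral_add_adjacent_intervals
      (walsh_mul_intervalIntegrable n m 0 (1 / 2)) (walsh_mul_intervalIntegrable n m (1 / 2) 1)]
    norm_num at this ⊢
    rw [← this]; ring

lemma orth_Ico (n m : ℕ) :
    ∫ x in Set.Ico (0:ℝ) 1, walsh n x * walsh m x = if n = m then 1 else 0 := by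
  split_ifs with h
  · subst h; simp [walsh_mul_self]
  · rw [integral_Ico_eq_integral_Ioc, ← intervalIntegral.integral_of_le (by norm_num),
      orth_interval n m h]

/-- Double Walsh functions. -/
noncomputable def dw (k : ℕ × ℕ) (p : ℝ × ℝ) : ℝ := walsh k.1 p.1 * walsh k.2 p.2

lemma measurable_dw (k : ℕ × ℕ) : Measurable (dw k) :=
  ((measurable_walsh _).comp measurable_fst).mul ((measurable_walsh _).comp measurable_snd)

lemma abs_dw (k : ℕ × ℕ) (p : ℝ × ℝ) : |dw k p| = 1 := by simp [dw, abs_mul, abs_walsh]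

/-- half-open square -/
def TT : Set (ℝ × ℝ) := Set.Ico (0:ℝ) 1 ×ˢ Set.Ico (0:ℝ) 1

lemma volume_TT : volume TT = 1 := by
  simp [TT, Measure.volume_eq_prod, Measure.prod_prod]

lemma measurableSet_TT : MeasurableSet TT := measurableSet_Ico.prod measurableSet_Ico

lemma orth_dw (k l : ℕ × ℕ) :
    ∫ p in TT, dw k p * dw l p = if k = l then 1 else 0 := by
  have : ∀ p : ℝ × ℝ, dw k p * dw l p =
    (walsh k.1 p.1 * walsh l.1 p.1) * (walsh k.2 p.2 * walsh l.2 p.2) := by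
    intro p; unfold dw; ring
  simp_rw [this]
  rw [TT, Measure.volume_eq_prod,
    setIntegral_prod_mul (fun x => walsh k.1 x * walsh l.1 x) (fun x => walsh k.2 x * walsh l.2 x),
    orth_Ico, orth_Ico]
  by_cases h1 : k.1 = l.1 <;> by_cases h2 : k.2 = l.2 <;> simp [h1, h2, Prod.ext_iff]

lemma integrable_of_bdd (e : Set (ℝ × ℝ)) (he : e ⊆ TT) (g : ℝ × ℝ → ℝ) (hg : Measurable g)
    (C : ℝ) (hC : ∀ p, |g p| ≤ C) : IntegrableOn g e := by
  have hfin : volume e ≠ ⊤ :=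
    ne_top_of_le_ne_top (by rw [volume_TT]; norm_num) (measure_mono he)
  exact Measure.integrableOn_of_bounded hfin hg.aestronglyMeasurable (M := C)
    (Filter.Eventually.of_forall hC)

lemma measurable_poly (F : Finset (ℕ × ℕ)) (d : ℕ × ℕ → ℝ) :
    Measurable (fun p => ∑ k ∈ F, d k * dw k p) :=
  Finset.measurable_sum _ fun k _ => measurable_const.mul (measurable_dw k)

lemma bdd_poly (F : Finset (ℕ × ℕ)) (d : ℕ × ℕ → ℝ) (p : ℝ × ℝ) :
    |∑ k ∈ F, d k * dw k p| ≤ ∑ k ∈ F, |d k| := by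
  refine (Finset.abs_sum_le_sum_abs _ _).trans (le_of_eq ?_)
  simp [abs_mul, abs_dw]

lemma parseval (F : Finset (ℕ × ℕ)) (d : ℕ × ℕ → ℝ) :
    ∫ p in TT, (∑ k ∈ F, d k * dw k p) ^ 2 = ∑ k ∈ F, d k ^ 2 := by
  have : ∀ p, (∑ k ∈ F, d k * dw k p) ^ 2 = 
      ∑ k ∈ F, ∑ l ∈ F, (d k * d l) * (dw k p * dw l p) := by
    intro p
    rw [sq, Finset.sum_mul_sum]
    refine Finset.sum_congr rfl fun k _ => Finset.sum_congr rfl fun l _ => by ring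
  simp_rw [this]
  have hi : ∀ k l, IntegrableOn (fun p => (d k * d l) * (dw k p * dw l p)) TT := by
    intro k l
    refine integrable_of_bdd TT subset_rfl _
      (measurable_const.mul ((measurable_dw k).mul (measurable_dw l))) (|d k * d l|) ?_
    intro p; simp [abs_mul, abs_dw]
  rw [integral_finsetSum _ fun k _ => integrable_finsetSum _ fun l _ => hi k l]
  refine Finset.sum_congr rfl fun k hk => ?_
  rw [integral_finsetSum _ fun l _ => hi k l]
  simp_rw [integral_const_mul, orth_dw]
  simp [hk, sq]

lemma L1_bound (F : Finset (ℕ × ℕ)) (d : ℕ × ℕ → ℝ) (δ : ℝ) (hδ : 0 < δ)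
    (h : ∑ k ∈ F, d k ^ 2 ≤ δ ^ 2) (e : Set (ℝ × ℝ)) (he : e ⊆ TT) :
    ∫ p in e, |∑ k ∈ F, d k * dw k p| ≤ δ := by
  have hm := measurable_poly F d
  have hb := bdd_poly F d
  have i1 : IntegrableOn (fun p => |∑ k ∈ F, d k * dw k p|) TT :=
    integrable_of_bdd TT subset_rfl _ hm.abs _ (fun p => by rw [abs_abs]; exact hb p)
  have i2 : IntegrableOn (fun p => (∑ k ∈ F, d k * dw k p) ^ 2) TT :=
    integrable_of_bdd TT subset_rfl _ (hm.pow_const 2) ((∑ k ∈ F, |d k|) ^ 2)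
      (fun p => by rw [abs_pow]; exact pow_le_pow_left₀ (abs_nonneg _) (hb p) 2)
  have i3 : IntegrableOn (fun _ : ℝ × ℝ => δ / 2) TT :=
    integrable_of_bdd TT subset_rfl _ measurable_const |δ / 2| (fun p => le_rfl)
  calc ∫ p in e, |∑ k ∈ F, d k * dw k p| ≤ ∫ p in TT, |∑ k ∈ F, d k * dw k p| :=
        setIntegral_mono_set i1 (Filter.Eventually.of_forall fun p => abs_nonneg _)
          (Filter.Eventually.of_forall he)
    _ ≤ ∫ p in TT, (δ / 2 + (1 / (2 * δ)) * (∑ k ∈ F, d k * dw k p) ^ 2) := by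
        refine setIntegral_mono i1 (i3.add (i2.const_mul _)) fun p => ?_
        have : 0 ≤ (δ - |∑ k ∈ F, d k * dw k p|) ^ 2 / (2 * δ) := by positivity
        simp only
        rw [← sq_abs (∑ k ∈ F, d k * dw k p)]
        have e : (δ - |∑ k ∈ F, d k * dw k p|) ^ 2 / (2 * δ) =
          (δ / 2 + (1 / (2 * δ)) * |∑ k ∈ F, d k * dw k p| ^ 2) - |∑ k ∈ F, d k * dw k p| := by
          field_simp; ring
        linarith
    _ = δ / 2 + (1 / (2 * δ)) * ∑ k ∈ F, d k ^ 2 := by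
        rw [integral_add i3 (i2.const_mul _), integral_const_mul, parseval]
        simp [Measure.real, volume_TT]
    _ ≤ δ / 2 + (1 / (2 * δ)) * δ ^ 2 := by gcongr
    _ = δ := by field_simp; ring

lemma sum_range_block (F : ℕ → ℝ) (A B : ℕ) :
    ∑ k ∈ Finset.range (A * B), F k =
      ∑ j ∈ Finset.range B, ∑ r ∈ Finset.range A, F (r + j * A) := by
  induction B with
  | zero => simp
  | succ B ih =>
    rw [mul_add, mul_one, Finset.sum_range_add, ih, Finset.sum_range_succ]
    congr 1
    refine Finset.sum_congr rfl fun r _ => ?_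
    congr 1; ring

lemma sum_range_trunc (F : ℕ → ℝ) (A B : ℕ) (h : A ≤ B) :
    ∑ r ∈ Finset.range B, (if r < A then F r else 0) = ∑ r ∈ Finset.range A, F r := by
  rw [← Finset.sum_filter]
  congr 1
  ext r; simp; omega

/-- Coefficients of the one-dimensional block function. -/
noncomputable def aco (m L q : ℕ) (x0 : ℝ) (k : ℕ) : ℝ :=
  if 2 ^ L ≤ k ∧ k < 2 ^ (L + q) ∧ k % 2 ^ L < 2 ^ m then -(2 ^ m)⁻¹ * walsh (k % 2 ^ L) x0 else 0

lemma aco_eval (m L q : ℕ) (x0 : ℝ) (r j : ℕ) (hr : r < 2 ^ L) (hj : j < 2 ^ q) :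
    aco m L q x0 (r + j * 2 ^ L) =
      if j = 0 then 0 else if r < 2 ^ m then -(2 ^ m)⁻¹ * walsh r x0 else 0 := by
  have h1 : (r + j * 2 ^ L) % 2 ^ L = r := by
    rw [Nat.add_mul_mod_self_right, Nat.mod_eq_of_lt hr]
  have h2 : r + j * 2 ^ L < 2 ^ (L + q) := by
    rw [pow_add]
    have : (j + 1) * 2 ^ L ≤ 2 ^ q * 2 ^ L := Nat.mul_le_mul_right _ hj
    nlinarith
  unfold aco
  rw [h1]
  by_cases h0 : j = 0
  · subst h0
    rw [if_neg (by simp; omega), if_pos rfl]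
  · have h3 : 2 ^ L ≤ r + j * 2 ^ L := by
      have : 1 * 2 ^ L ≤ j * 2 ^ L := Nat.mul_le_mul_right _ (by omega)
      omega
    simp [h0, h2, h3]

lemma aco_support (m L q : ℕ) (x0 : ℝ) (k : ℕ) (h : aco m L q x0 k ≠ 0) :
    2 ^ L ≤ k ∧ k < 2 ^ (L + q) := by
  unfold aco at h
  split_ifs at h with h1
  · exact ⟨h1.1, h1.2.1⟩
  · exact absurd rfl h

lemma aco_abs (m L q : ℕ) (x0 : ℝ) (k : ℕ) : |aco m L q x0 k| ≤ (2 ^ m)⁻¹ := by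
  unfold aco
  split_ifs
  · rw [abs_mul, abs_walsh, abs_neg, abs_of_pos (by positivity), mul_one]
  · rw [abs_zero]; positivity

lemma aco_sum (m L q : ℕ) (hm : m ≤ L) (x0 x : ℝ) :
    ∑ k ∈ Finset.range (2 ^ (L + q)), aco m L q x0 k * walsh k x =
      (if ⌊(2:ℝ) ^ m * Int.fract x0⌋ = ⌊(2:ℝ) ^ m * Int.fract x⌋ then 1 else 0) *
        (1 - if Int.fract (2 ^ L * x) < (2 ^ q)⁻¹ then 2 ^ q else 0) := by
  rw [pow_add, sum_range_block, ← kernel_zero]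
  have hmL : 2 ^ m ≤ 2 ^ L := Nat.pow_le_pow_right (by norm_num) hm
  have step : ∀ j ∈ Finset.range (2 ^ q),
      ∑ r ∈ Finset.range (2 ^ L), aco m L q x0 (r + j * 2 ^ L) * walsh (r + j * 2 ^ L) x =
      (if ⌊(2:ℝ) ^ m * Int.fract x0⌋ = ⌊(2:ℝ) ^ m * Int.fract x⌋ then 1 else 0) *
        ((if j = 0 then 1 else 0) - walsh j (2 ^ L * x)) := by
    intro j hj
    rw [Finset.mem_range] at hj
    have : ∀ r ∈ Finset.range (2 ^ L),
        aco m L q x0 (r + j * 2 ^ L) * walsh (r + j * 2 ^ L) x =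
        ((2 ^ m)⁻¹ * ((if j = 0 then 1 else 0) - walsh j (2 ^ L * x))) *
          (if r < 2 ^ m then walsh r x0 * walsh r x else 0) := by
      intro r hr
      rw [Finset.mem_range] at hr
      rw [aco_eval _ _ _ _ _ _ hr hj, walsh_add _ _ _ _ hr]
      by_cases h0 : j = 0
      · subst h0; simp [walsh_zero']
      · rw [if_neg h0, if_neg h0]
        split_ifs <;> ring
    rw [Finset.sum_congr rfl this, ← Finset.mul_sum, sum_range_trunc _ _ _ hmL, kernel]
    split_ifs <;> field_simp <;> ring
  rw [Finset.sum_congr rfl step, ← Finset.mul_sum, Finset.sum_sub_distrib]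
  congr 2
  simp

lemma aco_sq (m L q : ℕ) (hm : m ≤ L) (x0 : ℝ) :
    ∑ k ∈ Finset.range (2 ^ (L + q)), aco m L q x0 k ^ 2 ≤ 2 ^ q * (2 ^ m)⁻¹ := by
  rw [pow_add, sum_range_block]
  have hmL : 2 ^ m ≤ 2 ^ L := Nat.pow_le_pow_right (by norm_num) hm
  have step : ∀ j ∈ Finset.range (2 ^ q),
      ∑ r ∈ Finset.range (2 ^ L), aco m L q x0 (r + j * 2 ^ L) ^ 2 ≤ ((2:ℝ) ^ m)⁻¹ := by
    intro j hj
    rw [Finset.mem_range] at hj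
    have : ∀ r ∈ Finset.range (2 ^ L), aco m L q x0 (r + j * 2 ^ L) ^ 2 ≤
          (if r < 2 ^ m then (((2:ℝ) ^ m)⁻¹) ^ 2 else 0) := by
      intro r hr
      rw [Finset.mem_range] at hr
      split_ifs with h
      · rw [← sq_abs]
        exact pow_le_pow_left₀ (abs_nonneg _) (aco_abs _ _ _ _ _) 2
      · rw [aco_eval _ _ _ _ _ _ hr hj]
        simp [h]
    refine (Finset.sum_le_sum this).trans ?_
    rw [sum_range_trunc _ _ _ hmL]
    simp
    field_simp
    rfl
  refine (Finset.sum_le_sum step).trans ?_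
  simp

/-- One-dimensional piece. -/
def cellA (m i L q : ℕ) : Set ℝ :=
  {x | x ∈ Set.Ico (0:ℝ) 1 ∧ ⌊(2:ℝ) ^ m * x⌋ = (i:ℤ) ∧ Int.fract (2 ^ L * x) < (2 ^ q)⁻¹}

lemma measurableSet_cellA (m i L q : ℕ) : MeasurableSet (cellA m i L q) := by
  have h1 : Measurable fun x : ℝ => ⌊(2:ℝ) ^ m * x⌋ :=
    Int.measurable_floor.comp (measurable_const.mul measurable_id)
  have h2 : Measurable fun x : ℝ => Int.fract ((2:ℝ) ^ L * x) :=
    measurable_fract.comp (measurable_const.mul measurable_id)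
  exact measurableSet_Ico.inter
    ((h1 (measurableSet_singleton _)).inter (measurableSet_lt h2 measurable_const))

lemma floor_x0 (m i : ℕ) (hi : i < 2 ^ m) :
    ⌊(2:ℝ) ^ m * Int.fract ((i:ℝ) / 2 ^ m)⌋ = i := by
  have hp : (0:ℝ) < 2 ^ m := by positivity
  have : Int.fract ((i:ℝ) / 2 ^ m) = (i:ℝ) / 2 ^ m := by
    rw [Int.fract_eq_self]
    refine ⟨by positivity, ?_⟩
    rw [div_lt_one hp]; exact_mod_cast hi
  rw [this, mul_div_cancel₀ _ hp.ne']
  exact Int.floor_natCast _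

lemma volume_cellA (m i L q : ℕ) (hm : m ≤ L) (hi : i < 2 ^ m) :
    volume.real (cellA m i L q) = (2 ^ m)⁻¹ * (2 ^ q)⁻¹ := by
  have hsub : cellA m i L q ⊆ Set.Ico 0 1 := fun x hx => hx.1
  have e1 : volume.real (cellA m i L q) =
      ∫ x in Set.Ico (0:ℝ) 1, (cellA m i L q).indicator (fun _ => (1:ℝ)) x := by
    rw [setIntegral_indicator (measurableSet_cellA m i L q),
      Set.inter_eq_self_of_subset_right hsub]
    simp
  have e2 : ∀ x ∈ Set.Ico (0:ℝ) 1, (cellA m i L q).indicator (fun _ => (1:ℝ)) x =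
      ∑ k ∈ Finset.range (2 ^ m), ∑ j ∈ Finset.range (2 ^ q),
        ((2 ^ m)⁻¹ * (2 ^ q)⁻¹ * walsh k ((i:ℝ) / 2 ^ m)) *
          (walsh (k + j * 2 ^ L) x * walsh 0 x) := by
    intro x hx
    have hmL : 2 ^ m ≤ 2 ^ L := Nat.pow_le_pow_right (by norm_num) hm
    have : ∑ k ∈ Finset.range (2 ^ m), ∑ j ∈ Finset.range (2 ^ q),
        ((2 ^ m)⁻¹ * (2 ^ q)⁻¹ * walsh k ((i:ℝ) / 2 ^ m)) *
          (walsh (k + j * 2 ^ L) x * walsh 0 x) =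
        ((2 ^ m)⁻¹ * (2 ^ q)⁻¹) * ((∑ k ∈ Finset.range (2 ^ m),
          walsh k x * walsh k ((i:ℝ) / 2 ^ m)) *
          ∑ j ∈ Finset.range (2 ^ q), walsh j (2 ^ L * x)) := by
      rw [Finset.sum_mul_sum, Finset.mul_sum]
      refine Finset.sum_congr rfl fun k hk => ?_
      rw [Finset.mul_sum]
      refine Finset.sum_congr rfl fun j hj => ?_
      rw [Finset.mem_range] at hk
      rw [walsh_add _ _ _ _ (by omega), walsh_zero']; ring
    rw [this, kernel, kernel_zero, floor_x0 m i hi, Int.fract_eq_self.2 ⟨hx.1, hx.2⟩]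
    by_cases h1 : ⌊(2:ℝ) ^ m * x⌋ = (i:ℤ)
    · by_cases h2 : Int.fract (2 ^ L * x) < ((2:ℝ) ^ q)⁻¹
      · rw [Set.indicator_of_mem (show x ∈ cellA m i L q from ⟨hx, h1, h2⟩), if_pos h1, if_pos h2]
        field_simp
      · rw [Set.indicator_of_notMem (fun h => h2 h.2.2), if_neg h2]; simp
    · rw [Set.indicator_of_notMem (fun h => h1 h.2.1), if_neg h1]; simp
  have hi' : ∀ n, Integrable (fun x => walsh n x * walsh 0 x)
      (volume.restrict (Set.Ico (0:ℝ) 1)) := by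
    intro n
    have := (walsh_mul_intervalIntegrable n 0 0 1)
    rw [intervalIntegrable_iff_integrableOn_Ico_of_le (by norm_num)] at this
    exact this
  rw [e1, setIntegral_congr_fun measurableSet_Ico e2,
    integral_finsetSum _ fun k _ => integrable_finsetSum _ fun j _ => (hi' _).const_mul _]
  simp_rw [integral_finsetSum _ fun j _ => (hi' _).const_mul _, integral_const_mul, orth_Ico]
  rw [Finset.sum_eq_single 0, Finset.sum_eq_single 0]
  · simp [walsh_zero']
  · intro j _ hj; simp [hj]
  · simp
  · intro k _ hk
    refine Finset.sum_eq_zero fun j _ => ?_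
    simp [hk]
  · simp

/-- The `ν`-th block of coefficients. -/
noncomputable def bterm (m q L0 : ℕ) (g : ℕ → ℝ) (ν : ℕ) (k : ℕ × ℕ) : ℝ :=
  g ν * (aco m (L0 + ν * q) q (((ν / 2 ^ m : ℕ) : ℝ) / 2 ^ m) k.1 *
    aco m (L0 + ν * q) q (((ν % 2 ^ m : ℕ) : ℝ) / 2 ^ m) k.2)

/-- All coefficients. -/
noncomputable def coef (m q L0 : ℕ) (g : ℕ → ℝ) (k : ℕ × ℕ) : ℝ :=
  ∑ ν ∈ Finset.range (2 ^ m * 2 ^ m), bterm m q L0 g ν k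

/-- The frequency block. -/
def Blk (q L0 ν : ℕ) (k : ℕ × ℕ) : Prop :=
  (2 ^ (L0 + ν * q) ≤ k.1 ∧ k.1 < 2 ^ (L0 + ν * q + q)) ∧
  (2 ^ (L0 + ν * q) ≤ k.2 ∧ k.2 < 2 ^ (L0 + ν * q + q))

/-- `p` belongs to the `ν`-th cell. -/
def inCell (m ν : ℕ) (p : ℝ × ℝ) : Prop :=
  ⌊(2:ℝ) ^ m * p.1⌋ = ((ν / 2 ^ m : ℕ) : ℤ) ∧ ⌊(2:ℝ) ^ m * p.2⌋ = ((ν % 2 ^ m : ℕ) : ℤ)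

/-- The good set. -/
def EE (m q L0 : ℕ) : Set (ℝ × ℝ) :=
  {p | p ∈ TT ∧ ∀ ν ∈ Finset.range (2 ^ m * 2 ^ m), inCell m ν p →
    (2 ^ q)⁻¹ ≤ Int.fract (2 ^ (L0 + ν * q) * p.1) ∧
    (2 ^ q)⁻¹ ≤ Int.fract (2 ^ (L0 + ν * q) * p.2)}

/-- Index of the cell of `p`. -/
noncomputable def cellIdx (m : ℕ) (p : ℝ × ℝ) : ℕ :=
  ⌊(2:ℝ) ^ m * p.1⌋.toNat * 2 ^ m + ⌊(2:ℝ) ^ m * p.2⌋.toNat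

lemma floor_TT (m : ℕ) (x : ℝ) (hx : x ∈ Set.Ico (0:ℝ) 1) :
    ∃ i : ℕ, i < 2 ^ m ∧ ⌊(2:ℝ) ^ m * x⌋ = i := by
  have h := floor_bd m x
  rw [Int.fract_eq_self.2 ⟨hx.1, hx.2⟩] at h
  refine ⟨⌊(2:ℝ) ^ m * x⌋.toNat, ?_, by omega⟩
  zify; omega

lemma cellIdx_lt (m : ℕ) (p : ℝ × ℝ) (hp : p ∈ TT) : cellIdx m p < 2 ^ m * 2 ^ m := by
  obtain ⟨i, hi, hi'⟩ := floor_TT m p.1 hp.1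
  obtain ⟨j, hj, hj'⟩ := floor_TT m p.2 hp.2
  simp only [cellIdx, hi', hj', Int.toNat_natCast]
  have : (i + 1) * 2 ^ m ≤ 2 ^ m * 2 ^ m := Nat.mul_le_mul_right _ hi
  nlinarith

lemma inCell_iff (m ν : ℕ) (p : ℝ × ℝ) (hp : p ∈ TT) : inCell m ν p ↔ ν = cellIdx m p := by
  obtain ⟨i, hi, hi'⟩ := floor_TT m p.1 hp.1
  obtain ⟨j, hj, hj'⟩ := floor_TT m p.2 hp.2
  simp only [cellIdx, inCell, hi', hj', Int.toNat_natCast, Nat.cast_inj]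
  constructor
  · rintro ⟨h1, h2⟩
    rw [h1, h2, mul_comm]; exact (Nat.div_add_mod _ _).symm
  · intro h
    rw [h]
    constructor
    · rw [mul_comm, Nat.mul_add_div (by positivity), Nat.div_eq_of_lt hj, add_zero]
    · rw [mul_comm, Nat.mul_add_mod, Nat.mod_eq_of_lt hj]

lemma term_support (m q L0 : ℕ) (g : ℕ → ℝ) (ν : ℕ) (k : ℕ × ℕ)
    (h : bterm m q L0 g ν k ≠ 0) : Blk q L0 ν k := by
  unfold bterm at h
  have h' := right_ne_zero_of_mul h
  exact ⟨aco_support _ _ _ _ _ (left_ne_zero_of_mul h'),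
    aco_support _ _ _ _ _ (right_ne_zero_of_mul h')⟩

lemma term_abs (m q L0 : ℕ) (g : ℕ → ℝ) (G : ℝ) (hG : ∀ ν, |g ν| ≤ G) (ν : ℕ) (k : ℕ × ℕ) :
    |bterm m q L0 g ν k| ≤ G * ((2 ^ m)⁻¹ * (2 ^ m)⁻¹) := by
  unfold bterm
  rw [abs_mul, abs_mul]
  have h0 : 0 ≤ G := (abs_nonneg _).trans (hG ν)
  gcongr
  · exact hG ν
  · exact aco_abs _ _ _ _ _
  · exact aco_abs _ _ _ _ _

lemma Blk_range (q L0 ν : ℕ) (k : ℕ × ℕ) (h : Blk q L0 ν k) :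
    k ∈ Finset.range (2 ^ (L0 + ν * q + q)) ×ˢ Finset.range (2 ^ (L0 + ν * q + q)) := by
  simp only [Finset.mem_product, Finset.mem_range]
  exact ⟨h.1.2, h.2.2⟩

lemma term_sq (m q L0 : ℕ) (hm : m ≤ L0) (g : ℕ → ℝ) (G : ℝ) (hG : ∀ ν, |g ν| ≤ G) (ν : ℕ)
    (F : Finset (ℕ × ℕ)) :
    ∑ k ∈ F, bterm m q L0 g ν k ^ 2 ≤ (G * (2 ^ q * (2 ^ m)⁻¹)) ^ 2 := by
  have h1 : ∑ k ∈ F, bterm m q L0 g ν k ^ 2 ≤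
      ∑ k ∈ Finset.range (2 ^ (L0 + ν * q + q)) ×ˢ Finset.range (2 ^ (L0 + ν * q + q)),
        bterm m q L0 g ν k ^ 2 := by
    rw [← Finset.sum_filter_ne_zero]
    refine Finset.sum_le_sum_of_subset_of_nonneg ?_ fun _ _ _ => sq_nonneg _
    intro k hk
    rw [Finset.mem_filter] at hk
    exact Blk_range _ _ _ _ (term_support m q L0 g ν k (by
      intro h; exact hk.2 (by rw [h]; norm_num)))
  refine h1.trans ?_
  have h0 : 0 ≤ G := (abs_nonneg _).trans (hG ν)
  have hL : m ≤ L0 + ν * q := by omega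
  have := aco_sq m (L0 + ν * q) q hL (((ν / 2 ^ m : ℕ) : ℝ) / 2 ^ m)
  have h' := aco_sq m (L0 + ν * q) q hL (((ν % 2 ^ m : ℕ) : ℝ) / 2 ^ m)
  simp only [bterm, mul_pow]
  rw [← Finset.mul_sum, Finset.sum_product]
  simp only
  rw [← Finset.sum_mul_sum]
  have hg : g ν ^ 2 ≤ G ^ 2 := by
    rw [← sq_abs]; exact pow_le_pow_left₀ (abs_nonneg _) (hG ν) 2
  have : (∑ k ∈ Finset.range (2 ^ (L0 + ν * q + q)),
        aco m (L0 + ν * q) q (((ν / 2 ^ m : ℕ) : ℝ) / 2 ^ m) k ^ 2) *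
      (∑ k ∈ Finset.range (2 ^ (L0 + ν * q + q)),
        aco m (L0 + ν * q) q (((ν % 2 ^ m : ℕ) : ℝ) / 2 ^ m) k ^ 2) ≤
      (2 ^ q * (2 ^ m)⁻¹) * (2 ^ q * (2 ^ m)⁻¹) :=
    mul_le_mul this h' (Finset.sum_nonneg fun _ _ => sq_nonneg _) (by positivity)
  calc _ ≤ G ^ 2 * ((2 ^ q * (2 ^ m)⁻¹) * (2 ^ q * (2 ^ m)⁻¹)) :=
        mul_le_mul hg this (mul_nonneg (Finset.sum_nonneg fun _ _ => sq_nonneg _)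
          (Finset.sum_nonneg fun _ _ => sq_nonneg _)) (by positivity)
    _ = _ := by ring

lemma full_block (m q L0 : ℕ) (hm : m ≤ L0) (g : ℕ → ℝ) (ν : ℕ) (hν : ν < 2 ^ m * 2 ^ m)
    (F : Finset (ℕ × ℕ)) (hF : ∀ k, Blk q L0 ν k → k ∈ F) (p : ℝ × ℝ) (hp : p ∈ EE m q L0) :
    ∑ k ∈ F, bterm m q L0 g ν k * dw k p = if ν = cellIdx m p then g ν else 0 := by
  have key : ∀ F : Finset (ℕ × ℕ), (∀ k, Blk q L0 ν k → k ∈ F) →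
      ∑ k ∈ F, bterm m q L0 g ν k * dw k p =
      ∑ k ∈ F.filter (Blk q L0 ν), bterm m q L0 g ν k * dw k p := by
    intro F _
    rw [Finset.sum_filter]
    refine Finset.sum_congr rfl fun k _ => ?_
    split_ifs with h
    · rfl
    · by_contra hne
      exact h (term_support m q L0 g ν k (left_ne_zero_of_mul hne))
  have e1 : ∑ k ∈ F, bterm m q L0 g ν k * dw k p =
      ∑ k ∈ Finset.range (2 ^ (L0 + ν * q + q)) ×ˢ Finset.range (2 ^ (L0 + ν * q + q)),
        bterm m q L0 g ν k * dw k p := by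
    rw [key F hF, key _ (Blk_range q L0 ν)]
    congr 1
    ext k
    simp only [Finset.mem_filter]
    exact ⟨fun h => ⟨Blk_range _ _ _ _ h.2, h.2⟩, fun h => ⟨hF _ h.2, h.2⟩⟩
  have hL : m ≤ L0 + ν * q := by omega
  have s1 := aco_sum m (L0 + ν * q) q hL (((ν / 2 ^ m : ℕ) : ℝ) / 2 ^ m) p.1
  have s2 := aco_sum m (L0 + ν * q) q hL (((ν % 2 ^ m : ℕ) : ℝ) / 2 ^ m) p.2
  rw [floor_x0 _ _ (Nat.div_lt_of_lt_mul hν), Int.fract_eq_self.2 ⟨hp.1.1.1, hp.1.1.2⟩] at s1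
  rw [floor_x0 _ _ (Nat.mod_lt _ (by positivity)), Int.fract_eq_self.2 ⟨hp.1.2.1, hp.1.2.2⟩] at s2
  have e2 : ∑ k ∈ Finset.range (2 ^ (L0 + ν * q + q)) ×ˢ Finset.range (2 ^ (L0 + ν * q + q)),
        bterm m q L0 g ν k * dw k p = g ν *
      ((∑ k ∈ Finset.range (2 ^ (L0 + ν * q + q)),
        aco m (L0 + ν * q) q (((ν / 2 ^ m : ℕ) : ℝ) / 2 ^ m) k * walsh k p.1) *
      (∑ k ∈ Finset.range (2 ^ (L0 + ν * q + q)),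
        aco m (L0 + ν * q) q (((ν % 2 ^ m : ℕ) : ℝ) / 2 ^ m) k * walsh k p.2)) := by
    rw [Finset.sum_mul_sum, Finset.mul_sum, Finset.sum_product]
    refine Finset.sum_congr rfl fun k _ => ?_
    rw [Finset.mul_sum]
    refine Finset.sum_congr rfl fun l _ => ?_
    simp only [bterm, dw]; ring
  rw [e1, e2, s1, s2]
  have hc := inCell_iff m ν p hp.1
  by_cases h : ν = cellIdx m p
  · have hin := hc.2 h
    obtain ⟨g1, g2⟩ := hp.2 ν (Finset.mem_range.2 hν) hin
    rw [if_pos h, if_pos hin.1.symm, if_pos hin.2.symm, if_neg (not_lt.2 g1), if_neg (not_lt.2 g2)]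
    ring
  · rw [if_neg h]
    by_cases h1 : ((ν / 2 ^ m : ℕ) : ℤ) = ⌊(2:ℝ) ^ m * p.1⌋
    · rw [if_neg (fun h2 => h (hc.1 ⟨h1.symm, h2.symm⟩) :
        ¬ ((ν % 2 ^ m : ℕ) : ℤ) = ⌊(2:ℝ) ^ m * p.2⌋)]
      ring
    · rw [if_neg h1]; ring

lemma Blk_lt (q L0 n ν : ℕ) (h : n < ν) (k k' : ℕ × ℕ) (hk : Blk q L0 ν k)
    (hk' : Blk q L0 n k') : k'.1 < k.1 ∧ k'.2 < k.2 := by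
  have : 2 ^ (L0 + n * q + q) ≤ 2 ^ (L0 + ν * q) := by
    apply Nat.pow_le_pow_right (by norm_num)
    have : (n + 1) * q ≤ ν * q := Nat.mul_le_mul_right _ h
    nlinarith
  obtain ⟨⟨a, b⟩, c, d⟩ := hk
  obtain ⟨⟨a', b'⟩, c', d'⟩ := hk'
  omega

lemma partial_sum (N m q L0 : ℕ) (hm : m ≤ L0) (hN : N ≤ 2 ^ L0) (g : ℕ → ℝ) (G : ℝ)
    (hG : ∀ ν, |g ν| ≤ G) (F : Finset (ℕ × ℕ))
    (hF : ∀ k ∈ F, ∀ k' : ℕ × ℕ, N ≤ k'.1 → N ≤ k'.2 → k'.1 ≤ k.1 → k'.2 ≤ k.2 → k' ∈ F) :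
    ∃ (n : ℕ) (d : ℕ × ℕ → ℝ), (∑ k ∈ F, d k ^ 2 ≤ (G * (2 ^ q * (2 ^ m)⁻¹)) ^ 2) ∧
      ∀ p ∈ EE m q L0, ∑ k ∈ F, coef m q L0 g k * dw k p =
        (if cellIdx m p < n then g (cellIdx m p) else 0) + ∑ k ∈ F, d k * dw k p := by
  have hswap : ∀ p, ∑ k ∈ F, coef m q L0 g k * dw k p =
      ∑ ν ∈ Finset.range (2 ^ m * 2 ^ m), ∑ k ∈ F, bterm m q L0 g ν k * dw k p := by
    intro p
    rw [Finset.sum_comm]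
    refine Finset.sum_congr rfl fun k _ => ?_
    rw [coef, Finset.sum_mul]
  by_cases hall : ∀ ν < 2 ^ m * 2 ^ m, ∀ k, Blk q L0 ν k → k ∈ F
  · refine ⟨2 ^ m * 2 ^ m, fun _ => 0, by simp; positivity, fun p hp => ?_⟩
    rw [hswap, if_pos (cellIdx_lt m p hp.1)]
    have : ∀ ν ∈ Finset.range (2 ^ m * 2 ^ m), ∑ k ∈ F, bterm m q L0 g ν k * dw k p =
        if ν = cellIdx m p then g ν else 0 := fun ν hν =>
      full_block m q L0 hm g ν (Finset.mem_range.1 hν) F (hall ν (Finset.mem_range.1 hν)) p hp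
    rw [Finset.sum_congr rfl this]
    simp [cellIdx_lt m p hp.1]
  · push Not at hall
    have hex : ∃ ν, ν < 2 ^ m * 2 ^ m ∧ ∃ k, Blk q L0 ν k ∧ k ∉ F := hall
    obtain ⟨n, ⟨hnK, k0, hk0, hk0F⟩, hmin⟩ : ∃ n, (n < 2 ^ m * 2 ^ m ∧ ∃ k, Blk q L0 n k ∧ k ∉ F) ∧
        ∀ ν < n, ¬ (ν < 2 ^ m * 2 ^ m ∧ ∃ k, Blk q L0 ν k ∧ k ∉ F) :=
      ⟨Nat.find hex, Nat.find_spec hex, fun ν hν => Nat.find_min hex hν⟩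
    refine ⟨n, bterm m q L0 g n, term_sq m q L0 hm g G hG n F, fun p hp => ?_⟩
    have : ∀ ν ∈ Finset.range (2 ^ m * 2 ^ m), ∑ k ∈ F, bterm m q L0 g ν k * dw k p =
        (if ν = cellIdx m p then (if ν < n then g ν else 0) else 0) +
        (if ν = n then ∑ k ∈ F, bterm m q L0 g n k * dw k p else 0) := by
      intro ν hν
      rw [Finset.mem_range] at hν
      rcases lt_trichotomy ν n with h | h | h
      · rw [full_block m q L0 hm g ν hν F _ p hp, if_pos h, if_neg (by omega : ¬ ν = n), add_zero]
        intro k hk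
        by_contra hkF
        exact hmin ν h ⟨hν, k, hk, hkF⟩
      · subst h; simp
      · rw [if_neg (by omega : ¬ ν < n), if_neg (by omega : ¬ ν = n), ite_self, add_zero]
        refine Finset.sum_eq_zero fun k hk => ?_
        by_contra hne
        have hb := term_support m q L0 g ν k (left_ne_zero_of_mul hne)
        have hlt := Blk_lt q L0 n ν h k k0 hb hk0
        have hN' : N ≤ 2 ^ (L0 + n * q) :=
          hN.trans (Nat.pow_le_pow_right (by norm_num) (by omega))
        exact hk0F (hF k hk k0 (hN'.trans hk0.1.1) (hN'.trans hk0.2.1) hlt.1.le hlt.2.le)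
    rw [hswap, Finset.sum_congr rfl this, Finset.sum_add_distrib]
    simp [cellIdx_lt m p hp.1, hnK]

lemma coef_pow (m q L0 : ℕ) (hm : m ≤ L0) (g : ℕ → ℝ) (G : ℝ) (hG : ∀ ν, |g ν| ≤ G)
    (ε : ℝ) (hε : 0 < ε) (F : Finset (ℕ × ℕ)) :
    ∑ k ∈ F, |coef m q L0 g k| ^ (2 + ε) ≤
      (G * ((2 ^ m)⁻¹ * (2 ^ m)⁻¹)) ^ ε * (G * 2 ^ q) ^ 2 := by
  have hG0 : 0 ≤ G := (abs_nonneg _).trans (hG 0)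
  have h1 : ∀ k, |coef m q L0 g k| ^ (2 + ε) ≤
      ∑ ν ∈ Finset.range (2 ^ m * 2 ^ m), |bterm m q L0 g ν k| ^ (2 + ε) := by
    intro k
    by_cases h : ∃ ν ∈ Finset.range (2 ^ m * 2 ^ m), bterm m q L0 g ν k ≠ 0
    · obtain ⟨ν, hν, hne⟩ := h
      have : coef m q L0 g k = bterm m q L0 g ν k := by
        unfold coef
        refine Finset.sum_eq_single ν (fun b _ hb => ?_) (fun h => absurd hν h)
        by_contra hb'
        have b1 := term_support m q L0 g ν k hne
        have b2 := term_support m q L0 g b k hb'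
        rcases lt_or_gt_of_ne hb with h | h
        · exact absurd (Blk_lt q L0 b ν h k k b1 b2).1 (lt_irrefl _)
        · exact absurd (Blk_lt q L0 ν b h k k b2 b1).1 (lt_irrefl _)
      rw [this]
      exact Finset.single_le_sum (f := fun ν => |bterm m q L0 g ν k| ^ (2 + ε))
        (fun _ _ => Real.rpow_nonneg (abs_nonneg _) _) hν
    · push Not at h
      have : coef m q L0 g k = 0 := Finset.sum_eq_zero h
      rw [this, abs_zero, Real.zero_rpow (by linarith)]
      exact Finset.sum_nonneg fun _ _ => Real.rpow_nonneg (abs_nonneg _) _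
  have h2 : ∀ ν k, |bterm m q L0 g ν k| ^ (2 + ε) ≤
      (G * ((2 ^ m)⁻¹ * (2 ^ m)⁻¹)) ^ ε * bterm m q L0 g ν k ^ 2 := by
    intro ν k
    rw [add_comm, Real.rpow_add_of_nonneg (abs_nonneg _) hε.le (by norm_num)]
    rw [show |bterm m q L0 g ν k| ^ (2:ℝ) = bterm m q L0 g ν k ^ 2 by
      rw [Real.rpow_two, sq_abs]]
    gcongr
    exact term_abs m q L0 g G hG ν k
  calc ∑ k ∈ F, |coef m q L0 g k| ^ (2 + ε)
      ≤ ∑ k ∈ F, ∑ ν ∈ Finset.range (2 ^ m * 2 ^ m),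
        (G * ((2 ^ m)⁻¹ * (2 ^ m)⁻¹)) ^ ε * bterm m q L0 g ν k ^ 2 :=
        Finset.sum_le_sum fun k _ => (h1 k).trans (Finset.sum_le_sum fun ν _ => h2 ν k)
    _ = (G * ((2 ^ m)⁻¹ * (2 ^ m)⁻¹)) ^ ε * ∑ ν ∈ Finset.range (2 ^ m * 2 ^ m),
        ∑ k ∈ F, bterm m q L0 g ν k ^ 2 := by
        rw [Finset.sum_comm, Finset.mul_sum]
        simp_rw [Finset.mul_sum]
    _ ≤ (G * ((2 ^ m)⁻¹ * (2 ^ m)⁻¹)) ^ ε * ∑ ν ∈ Finset.range (2 ^ m * 2 ^ m),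
        (G * (2 ^ q * (2 ^ m)⁻¹)) ^ 2 := by
        gcongr with ν _
        exact term_sq m q L0 hm g G hG ν F
    _ = _ := by
        rw [Finset.sum_const, Finset.card_range, nsmul_eq_mul]
        push_cast
        field_simp

lemma measurableSet_EE (m q L0 : ℕ) : MeasurableSet (EE m q L0) := by
  have h1 : ∀ m, Measurable fun p : ℝ × ℝ => ⌊(2:ℝ) ^ m * p.1⌋ := fun m =>
    Int.measurable_floor.comp (measurable_const.mul measurable_fst)
  have h1' : ∀ m, Measurable fun p : ℝ × ℝ => ⌊(2:ℝ) ^ m * p.2⌋ := fun m =>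
    Int.measurable_floor.comp (measurable_const.mul measurable_snd)
  have h2 : ∀ L, Measurable fun p : ℝ × ℝ => Int.fract ((2:ℝ) ^ L * p.1) := fun L =>
    measurable_fract.comp (measurable_const.mul measurable_fst)
  have h2' : ∀ L, Measurable fun p : ℝ × ℝ => Int.fract ((2:ℝ) ^ L * p.2) := fun L =>
    measurable_fract.comp (measurable_const.mul measurable_snd)
  refine measurableSet_TT.inter ?_
  have : {p : ℝ × ℝ | ∀ ν ∈ Finset.range (2 ^ m * 2 ^ m), inCell m ν p →
    ((2:ℝ) ^ q)⁻¹ ≤ Int.fract (2 ^ (L0 + ν * q) * p.1) ∧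
    ((2:ℝ) ^ q)⁻¹ ≤ Int.fract (2 ^ (L0 + ν * q) * p.2)} =
    ⋂ ν ∈ Finset.range (2 ^ m * 2 ^ m), ({p : ℝ × ℝ | inCell m ν p}ᶜ ∪
      {p | ((2:ℝ) ^ q)⁻¹ ≤ Int.fract (2 ^ (L0 + ν * q) * p.1) ∧
    ((2:ℝ) ^ q)⁻¹ ≤ Int.fract (2 ^ (L0 + ν * q) * p.2)}) := by
    ext p
    simp only [Set.mem_ofPred_eq, Set.mem_iInter, Set.mem_union, Set.mem_compl_iff, imp_iff_not_or]
  change MeasurableSet {p : ℝ × ℝ | ∀ ν ∈ Finset.range (2 ^ m * 2 ^ m), inCell m ν p →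
    ((2:ℝ) ^ q)⁻¹ ≤ Int.fract (2 ^ (L0 + ν * q) * p.1) ∧
    ((2:ℝ) ^ q)⁻¹ ≤ Int.fract (2 ^ (L0 + ν * q) * p.2)}
  rw [this]
  refine Finset.measurableSet_biInter _ fun ν _ => ?_
  refine MeasurableSet.union (MeasurableSet.compl ?_) ?_
  · exact (h1 m (measurableSet_singleton _)).inter (h1' m (measurableSet_singleton _))
  · exact (measurableSet_le measurable_const (h2 _)).inter
      (measurableSet_le measurable_const (h2' _))

lemma volume_EE (m q L0 : ℕ) (hm : m ≤ L0) : 1 - 2 * (2 ^ q)⁻¹ ≤ volume.real (EE m q L0) := by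
  set U : ℕ → Set (ℝ × ℝ) := fun ν =>
    (cellA m (ν / 2 ^ m) (L0 + ν * q) q ×ˢ cellA m (ν % 2 ^ m) (L0 + ν * q) 0) ∪
    (cellA m (ν / 2 ^ m) (L0 + ν * q) 0 ×ˢ cellA m (ν % 2 ^ m) (L0 + ν * q) q) with hU
  have hfinC : ∀ i L q, volume (cellA m i L q) ≠ ⊤ := fun i L q =>
    ne_top_of_le_ne_top (by simp) (measure_mono (show cellA m i L q ⊆ Set.Ico 0 1 from
      fun x hx => hx.1))
  have hUm : ∀ ν ∈ Finset.range (2 ^ m * 2 ^ m),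
      volume.real (U ν) ≤ 2 * ((2 ^ m)⁻¹ * (2 ^ m)⁻¹ * (2 ^ q)⁻¹) := by
    intro ν hν
    rw [Finset.mem_range] at hν
    have hL : m ≤ L0 + ν * q := by omega
    have a1 : ν / 2 ^ m < 2 ^ m := Nat.div_lt_of_lt_mul hν
    have a2 : ν % 2 ^ m < 2 ^ m := Nat.mod_lt _ (by positivity)
    refine (measureReal_union_le _ _).trans (le_of_eq ?_)
    rw [Measure.volume_eq_prod, measureReal_prod_prod, measureReal_prod_prod,
      volume_cellA _ _ _ _ hL a1, volume_cellA _ _ _ _ hL a2,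
      volume_cellA _ _ _ _ hL a1, volume_cellA _ _ _ _ hL a2]
    simp; ring
  have hsub : TT ⊆ EE m q L0 ∪ ⋃ ν ∈ Finset.range (2 ^ m * 2 ^ m), U ν := by
    intro p hp
    by_cases h : p ∈ EE m q L0
    · exact Or.inl h
    · right
      have h' : ¬ ∀ ν ∈ Finset.range (2 ^ m * 2 ^ m), inCell m ν p →
          (2 ^ q)⁻¹ ≤ Int.fract (2 ^ (L0 + ν * q) * p.1) ∧
          (2 ^ q)⁻¹ ≤ Int.fract (2 ^ (L0 + ν * q) * p.2) := fun h'' => h ⟨hp, h''⟩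
      push Not at h'
      obtain ⟨ν, hν, hc, hlt⟩ := h'
      refine Set.mem_biUnion hν ?_
      by_cases h1 : (2 ^ q)⁻¹ ≤ Int.fract (2 ^ (L0 + ν * q) * p.1)
      · exact Or.inr ⟨⟨hp.1, hc.1, by simpa using Int.fract_lt_one _⟩, hp.2, hc.2, hlt h1⟩
      · exact Or.inl ⟨⟨hp.1, hc.1, not_le.1 h1⟩, hp.2, hc.2, by simpa using Int.fract_lt_one _⟩
  have hUfin : ∀ ν, volume (U ν) ≠ ⊤ := by
    intro ν
    refine ne_top_of_le_ne_top (b := volume TT) (by rw [volume_TT]; simp) (measure_mono ?_)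
    rintro p (⟨h1, h2⟩ | ⟨h1, h2⟩) <;> exact ⟨h1.1, h2.1⟩
  have hEfin : volume (EE m q L0) ≠ ⊤ :=
    ne_top_of_le_ne_top (b := volume TT) (by rw [volume_TT]; simp)
      (measure_mono fun p hp => hp.1)
  have hUU : volume (⋃ ν ∈ Finset.range (2 ^ m * 2 ^ m), U ν) ≠ ⊤ :=
    ((measure_biUnion_lt_top (Finset.finite_toSet _) fun ν _ => (hUfin ν).lt_top)).ne
  have t1 : (1:ℝ) = volume.real TT := by simp [Measure.real, volume_TT]
  have t2 : volume.real TT ≤ volume.real (EE m q L0 ∪ ⋃ ν ∈ Finset.range (2 ^ m * 2 ^ m), U ν) :=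
    measureReal_mono hsub (measure_union_ne_top hEfin hUU)
  have t3 := measureReal_union_le (μ := volume) (EE m q L0)
    (⋃ ν ∈ Finset.range (2 ^ m * 2 ^ m), U ν)
  have t4 := measureReal_biUnion_finset_le (μ := volume) (Finset.range (2 ^ m * 2 ^ m)) U
  have t5 := Finset.sum_le_sum hUm
  rw [Finset.sum_const, Finset.card_range, nsmul_eq_mul] at t5
  have t6 : ((2 ^ m * 2 ^ m : ℕ) : ℝ) * (2 * ((2 ^ m)⁻¹ * (2 ^ m)⁻¹ * (2 ^ q)⁻¹)) =
    2 * (2 ^ q)⁻¹ := by push_cast; field_simp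
  linarith

lemma mem_cell_iff (m M i J : ℕ) (hM : M ≤ m) (x : ℝ)
    (h : ⌊(2:ℝ) ^ m * x⌋ = (i:ℤ)) (hx : 0 < Int.fract ((2:ℝ) ^ m * x)) :
    x ∈ Set.Icc (((J:ℝ) - 1) / 2 ^ M) ((J:ℝ) / 2 ^ M) ↔
      ((J:ℤ) - 1) * 2 ^ (m - M) ≤ i ∧ (i:ℤ) + 1 ≤ (J:ℤ) * 2 ^ (m - M) := by
  have hp : (0:ℝ) < 2 ^ M := by positivity
  have hp' : (0:ℝ) < 2 ^ (m - M) := by positivity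
  have e : (2:ℝ) ^ m = 2 ^ (m - M) * 2 ^ M := by rw [← pow_add]; congr 1; omega
  rw [Set.mem_Icc, div_le_iff₀ hp, le_div_iff₀ hp]
  have a1 : (J:ℝ) - 1 ≤ x * 2 ^ M ↔ ((J:ℤ) - 1) * 2 ^ (m - M) ≤ i := by
    rw [← h, Int.le_floor, e]
    push_cast
    constructor
    · intro h1; nlinarith
    · intro h1
      by_contra h2
      push Not at h2
      nlinarith
  have a2 : x * 2 ^ M ≤ (J:ℝ) ↔ (i:ℤ) + 1 ≤ (J:ℤ) * 2 ^ (m - M) := by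
    rw [Int.add_one_le_iff, ← h, ← not_le, ← not_lt, not_iff_not, Int.le_floor]
    have hne : (2:ℝ) ^ m * x ≠ (((J:ℤ) * 2 ^ (m - M) : ℤ) : ℝ) := by
      intro h1
      rw [h1, Int.fract_intCast] at hx
      exact lt_irrefl _ hx
    have : (((J:ℤ) * 2 ^ (m - M) : ℤ) : ℝ) ≤ 2 ^ m * x ↔
        (((J:ℤ) * 2 ^ (m - M) : ℤ) : ℝ) < 2 ^ m * x :=
      ⟨fun h => lt_of_le_of_ne h hne.symm, le_of_lt⟩
    rw [this, e]
    push_cast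
    constructor
    · intro h1; nlinarith
    · intro h1
      by_contra h2
      push Not at h2
      nlinarith
  rw [a1, a2]

lemma fract_pos_of (m L q : ℕ) (hm : m ≤ L) (x : ℝ) (h : (2 ^ q)⁻¹ ≤ Int.fract ((2:ℝ) ^ L * x)) :
    0 < Int.fract ((2:ℝ) ^ m * x) := by
  refine lt_of_le_of_ne (Int.fract_nonneg _) fun h0 => ?_
  obtain ⟨z, hz⟩ := Int.fract_eq_zero_iff.1 h0.symm
  have e : (2:ℝ) ^ L * x = ((2 ^ (L - m) * z : ℤ) : ℝ) := by
    push_cast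
    rw [hz, ← mul_assoc, ← pow_add]; congr 2; omega
  rw [e, Int.fract_intCast] at h
  have : (0:ℝ) < (2 ^ q)⁻¹ := by positivity
  linarith

lemma center_cell (m i : ℕ) : ⌊(2:ℝ) ^ m * (((i:ℝ) + 1 / 2) / 2 ^ m)⌋ = (i:ℤ) ∧
    0 < Int.fract ((2:ℝ) ^ m * (((i:ℝ) + 1 / 2) / 2 ^ m)) := by
  rw [mul_div_cancel₀ _ (by positivity)]
  constructor
  · rw [Int.floor_eq_iff]; push_cast; constructor <;> linarith
  · rw [add_comm, Int.fract_add_natCast, Int.fract_eq_self.2 (by norm_num)]; norm_num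

/-- The step function. -/
noncomputable def stepF (ν0 : ℕ) (γ : ℕ → ℝ) (m1 m2 j1 j2 : ℕ → ℕ) (p : ℝ × ℝ) : ℝ :=
  ∑ ν ∈ Finset.range ν0, γ ν * Set.indicator
          (Set.Icc (((j1 ν : ℝ) - 1) / 2 ^ m1 ν) ((j1 ν : ℝ) / 2 ^ m1 ν) ×ˢ
            Set.Icc (((j2 ν : ℝ) - 1) / 2 ^ m2 ν) ((j2 ν : ℝ) / 2 ^ m2 ν)) (fun _ => (1:ℝ)) p

/-- center of a cell -/
noncomputable def ctr (m ν : ℕ) : ℝ × ℝ :=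
  ((((ν / 2 ^ m : ℕ) : ℝ) + 1 / 2) / 2 ^ m, (((ν % 2 ^ m : ℕ) : ℝ) + 1 / 2) / 2 ^ m)

lemma stepF_const (ν0 : ℕ) (γ : ℕ → ℝ) (m1 m2 j1 j2 : ℕ → ℕ) (m q L0 : ℕ) (hm : m ≤ L0)
    (h1 : ∀ ν < ν0, m1 ν ≤ m) (h2 : ∀ ν < ν0, m2 ν ≤ m) (p : ℝ × ℝ) (hp : p ∈ EE m q L0) :
    stepF ν0 γ m1 m2 j1 j2 (ctr m (cellIdx m p)) = stepF ν0 γ m1 m2 j1 j2 p := by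
  have hc := (inCell_iff m (cellIdx m p) p hp.1).2 rfl
  obtain ⟨g1, g2⟩ := hp.2 _ (Finset.mem_range.2 (cellIdx_lt m p hp.1)) hc
  have f1 := fract_pos_of m _ q (by omega) _ g1
  have f2 := fract_pos_of m _ q (by omega) _ g2
  unfold stepF
  refine Finset.sum_congr rfl fun ν hν => ?_
  rw [Finset.mem_range] at hν
  congr 1
  have c1 := center_cell m (cellIdx m p / 2 ^ m)
  have c2 := center_cell m (cellIdx m p % 2 ^ m)
  have : ctr m (cellIdx m p) ∈ (Set.Icc (((j1 ν : ℝ) - 1) / 2 ^ m1 ν) ((j1 ν : ℝ) / 2 ^ m1 ν) ×ˢ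
            Set.Icc (((j2 ν : ℝ) - 1) / 2 ^ m2 ν) ((j2 ν : ℝ) / 2 ^ m2 ν)) ↔
      p ∈ (Set.Icc (((j1 ν : ℝ) - 1) / 2 ^ m1 ν) ((j1 ν : ℝ) / 2 ^ m1 ν) ×ˢ
            Set.Icc (((j2 ν : ℝ) - 1) / 2 ^ m2 ν) ((j2 ν : ℝ) / 2 ^ m2 ν)) := by
    rw [Set.mem_prod, Set.mem_prod, mem_cell_iff m _ _ _ (h1 ν hν) _ hc.1 f1,
      mem_cell_iff m _ _ _ (h2 ν hν) _ hc.2 f2]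
    unfold ctr
    rw [mem_cell_iff m _ _ _ (h1 ν hν) _ c1.1 c1.2, mem_cell_iff m _ _ _ (h2 ν hν) _ c2.1 c2.2]
  simp only [Set.indicator, this]

lemma stepF_abs (ν0 : ℕ) (γ : ℕ → ℝ) (m1 m2 j1 j2 : ℕ → ℕ) (p : ℝ × ℝ) :
    |stepF ν0 γ m1 m2 j1 j2 p| ≤ ∑ ν ∈ Finset.range ν0, |γ ν| := by
  unfold stepF
  refine (Finset.abs_sum_le_sum_abs _ _).trans (Finset.sum_le_sum fun ν _ => ?_)
  rw [abs_mul]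
  refine mul_le_of_le_one_right (abs_nonneg _) ?_
  unfold Set.indicator
  split_ifs <;> norm_num

lemma stepF_measurable (ν0 : ℕ) (γ : ℕ → ℝ) (m1 m2 j1 j2 : ℕ → ℕ) :
    Measurable (stepF ν0 γ m1 m2 j1 j2) := by
  unfold stepF
  exact Finset.measurable_sum _ fun ν _ => measurable_const.mul
    (measurable_const.indicator (measurableSet_Icc.prod measurableSet_Icc))

lemma partial_int (ν0 : ℕ) (γ : ℕ → ℝ) (m1 m2 j1 j2 : ℕ → ℕ) (N m q L0 : ℕ) (hm : m ≤ L0)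
    (hN : N ≤ 2 ^ L0) (h1 : ∀ ν < ν0, m1 ν ≤ m) (h2 : ∀ ν < ν0, m2 ν ≤ m)
    (G : ℝ) (hG : ∀ p, |stepF ν0 γ m1 m2 j1 j2 p| ≤ G) (δ : ℝ) (hδ : 0 < δ)
    (hGδ : G * (2 ^ q * (2 ^ m)⁻¹) ≤ δ) (F : Finset (ℕ × ℕ))
    (hF : ∀ k ∈ F, ∀ k' : ℕ × ℕ, N ≤ k'.1 → N ≤ k'.2 → k'.1 ≤ k.1 → k'.2 ≤ k.2 → k' ∈ F)
    (e : Set (ℝ × ℝ)) (he : e ⊆ EE m q L0) (hem : MeasurableSet e) :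
    ∫ p in e, |∑ k ∈ F, coef m q L0 (fun ν => stepF ν0 γ m1 m2 j1 j2 (ctr m ν)) k * dw k p| ≤
      (∫ p in e, |stepF ν0 γ m1 m2 j1 j2 p|) + δ := by
  obtain ⟨n, d, hd, hsum⟩ := partial_sum N m q L0 hm hN
    (fun ν => stepF ν0 γ m1 m2 j1 j2 (ctr m ν)) G (fun ν => hG _) F hF
  have heT : e ⊆ TT := fun p hp => (he hp).1
  have hG0 : 0 ≤ G := (abs_nonneg _).trans (hG 0)
  have hd' : ∑ k ∈ F, d k ^ 2 ≤ δ ^ 2 :=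
    hd.trans (pow_le_pow_left₀ (by positivity) hGδ 2)
  have hL := L1_bound F d δ hδ hd' e heT
  have i0 : IntegrableOn (fun p => |∑ k ∈ F,
      coef m q L0 (fun ν => stepF ν0 γ m1 m2 j1 j2 (ctr m ν)) k * dw k p|) e :=
    integrable_of_bdd e heT _ (measurable_poly F _).abs _
      (fun p => by rw [abs_abs]; exact bdd_poly F _ p)
  have i1 : IntegrableOn (fun p => |stepF ν0 γ m1 m2 j1 j2 p|) e :=
    integrable_of_bdd e heT _ (stepF_measurable ν0 γ m1 m2 j1 j2).abs G
      (fun p => by rw [abs_abs]; exact hG p)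
  have i2 : IntegrableOn (fun p => |∑ k ∈ F, d k * dw k p|) e :=
    integrable_of_bdd e heT _ (measurable_poly F _).abs _
      (fun p => by rw [abs_abs]; exact bdd_poly F _ p)
  calc _ ≤ ∫ p in e, (|stepF ν0 γ m1 m2 j1 j2 p| + |∑ k ∈ F, d k * dw k p|) := by
        refine setIntegral_mono_on i0 (i1.add i2) hem fun p hp => ?_
        rw [hsum p (he hp), stepF_const ν0 γ m1 m2 j1 j2 m q L0 hm h1 h2 p (he hp)]
        refine (abs_add_le _ _).trans ?_
        refine add_le_add ?_ le_rfl
        split_ifs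
        · exact le_rfl
        · simp
    _ = (∫ p in e, |stepF ν0 γ m1 m2 j1 j2 p|) + ∫ p in e, |∑ k ∈ F, d k * dw k p| :=
        integral_add i1 i2
    _ ≤ _ := by gcongr

lemma choose_m (G ε : ℝ) (hε : 0 < ε) (q m0 : ℕ) : ∃ m, m0 ≤ m ∧
    G * (2 ^ q * (2 ^ m)⁻¹) ≤ ε / 2 ∧
    (G * ((2 ^ m)⁻¹ * (2 ^ m)⁻¹)) ^ ε * (G * 2 ^ q) ^ 2 < ε := by
  have t0 : Filter.Tendsto (fun m : ℕ => ((2:ℝ) ^ m)⁻¹) Filter.atTop (nhds 0) := by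
    have := tendsto_pow_atTop_nhds_zero_of_lt_one (r := (1/2:ℝ)) (by norm_num) (by norm_num)
    refine this.congr fun m => ?_
    simp
  have t1 : Filter.Tendsto (fun m : ℕ => G * (2 ^ q * ((2:ℝ) ^ m)⁻¹)) Filter.atTop (nhds 0) := by
    simpa using (t0.const_mul (2 ^ q : ℝ)).const_mul G
  have t2 : Filter.Tendsto (fun m : ℕ => G * (((2:ℝ) ^ m)⁻¹ * ((2:ℝ) ^ m)⁻¹))
      Filter.atTop (nhds 0) := by
    simpa using (t0.mul t0).const_mul G
  have t3 : Filter.Tendsto (fun m : ℕ => (G * (((2:ℝ) ^ m)⁻¹ * ((2:ℝ) ^ m)⁻¹)) ^ ε *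
      (G * 2 ^ q) ^ 2) Filter.atTop (nhds 0) := by
    have := (t2.rpow_const (p := ε) (Or.inr hε.le)).mul_const ((G * 2 ^ q) ^ 2)
    rwa [Real.zero_rpow hε.ne', zero_mul] at this
  have := (t1.eventually (gt_mem_nhds (half_pos hε))).and
    ((t3.eventually (gt_mem_nhds hε)).and (Filter.eventually_ge_atTop m0))
  obtain ⟨m, a, b, c⟩ := this.exists
  exact ⟨m, c, a.le, b⟩

/-- Lemma 3: approximation of a step function over dyadic rectangles of `[0,1]²`
by a double Walsh polynomial, with control of the coefficients and of all rectangular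
and spherical partial sums on subsets of the exceptional set. -/
theorem lemma_three (ε : ℝ) (hε0 : 0 < ε) (N : ℕ) (hN : 1 < N)
    (ν0 : ℕ) (γ : ℕ → ℝ) (m1 m2 j1 j2 : ℕ → ℕ)
    (hj1 : ∀ ν < ν0, 1 ≤ j1 ν ∧ j1 ν ≤ 2 ^ m1 ν)
    (hj2 : ∀ ν < ν0, 1 ≤ j2 ν ∧ j2 ν ≤ 2 ^ m2 ν) :
    ∃ (E : Set (ℝ × ℝ)) (M : ℕ) (c : ℕ → ℕ → ℝ),
      MeasurableSet E ∧ E ⊆ T ∧ N ≤ M ∧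
      volume E > ENNReal.ofReal (1 - ε) ∧
      (∑ k ∈ Finset.Icc N M, ∑ s ∈ Finset.Icc N M, |c k s| ^ (2 + ε) < ε) ∧
      (∀ p ∈ E, ∑ k ∈ Finset.Icc N M, ∑ s ∈ Finset.Icc N M,
          c k s * walsh k p.1 * walsh s p.2 =
        ∑ ν ∈ Finset.range ν0, γ ν * Set.indicator
          (Set.Icc (((j1 ν : ℝ) - 1) / 2 ^ m1 ν) ((j1 ν : ℝ) / 2 ^ m1 ν) ×ˢ
            Set.Icc (((j2 ν : ℝ) - 1) / 2 ^ m2 ν) ((j2 ν : ℝ) / 2 ^ m2 ν)) (fun _ => (1:ℝ)) p) ∧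
      (∀ e ⊆ E, MeasurableSet e →
        ∀ nb ∈ Finset.Ico N M, ∀ mb ∈ Finset.Ico N M,
        ∀ R : ℝ, Real.sqrt 2 * N ≤ R → R ≤ Real.sqrt 2 * M →
        (∫ p in e, |∑ k ∈ Finset.Icc N nb, ∑ s ∈ Finset.Icc N mb,
            c k s * walsh k p.1 * walsh s p.2|) +
        (∫ p in e, |∑ ks ∈ (Finset.Icc N M ×ˢ Finset.Icc N M).filter
            (fun ks => 2 * N ^ 2 ≤ ks.1 ^ 2 + ks.2 ^ 2 ∧
              ((ks.1 ^ 2 + ks.2 ^ 2 : ℕ) : ℝ) ≤ R ^ 2),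
            c ks.1 ks.2 * walsh ks.1 p.1 * walsh ks.2 p.2|) ≤
        2 * (∫ p in e, |∑ ν ∈ Finset.range ν0, γ ν * Set.indicator
          (Set.Icc (((j1 ν : ℝ) - 1) / 2 ^ m1 ν) ((j1 ν : ℝ) / 2 ^ m1 ν) ×ˢ
            Set.Icc (((j2 ν : ℝ) - 1) / 2 ^ m2 ν) ((j2 ν : ℝ) / 2 ^ m2 ν))
            (fun _ => (1:ℝ)) p|) + ε) := by
  obtain ⟨q, hq⟩ : ∃ q : ℕ, 2 * ((2:ℝ) ^ q)⁻¹ < min ε 1 := by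
    obtain ⟨q, hq⟩ := exists_pow_lt_of_lt_one (show 0 < min ε 1 / 2 by positivity)
      (show (1 / 2 : ℝ) < 1 by norm_num)
    refine ⟨q, ?_⟩
    have : ((2:ℝ) ^ q)⁻¹ = (1 / 2) ^ q := by simp
    rw [this]; linarith
  set G : ℝ := ∑ ν ∈ Finset.range ν0, |γ ν| + 1 with hGdef
  have hGpos : 0 < G := by
    have : 0 ≤ ∑ ν ∈ Finset.range ν0, |γ ν| := Finset.sum_nonneg fun _ _ => abs_nonneg _
    linarith
  have hG : ∀ p, |stepF ν0 γ m1 m2 j1 j2 p| ≤ G := fun p =>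
    (stepF_abs ν0 γ m1 m2 j1 j2 p).trans (by linarith)
  obtain ⟨m, hm0, hm1, hm2⟩ := choose_m G ε hε0 q
    (∑ ν ∈ Finset.range ν0, m1 ν + ∑ ν ∈ Finset.range ν0, m2 ν)
  have h1 : ∀ ν < ν0, m1 ν ≤ m := fun ν hν => by
    have := Finset.single_le_sum (f := m1) (fun _ _ => Nat.zero_le _) (Finset.mem_range.2 hν)
    omega
  have h2 : ∀ ν < ν0, m2 ν ≤ m := fun ν hν => by
    have := Finset.single_le_sum (f := m2) (fun _ _ => Nat.zero_le _) (Finset.mem_range.2 hν)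
    omega
  set L0 := m + N with hL0
  have hm : m ≤ L0 := by omega
  have hNL : N ≤ 2 ^ L0 := (by omega : N ≤ L0).trans (Nat.lt_two_pow_self).le
  set g : ℕ → ℝ := fun ν => stepF ν0 γ m1 m2 j1 j2 (ctr m ν) with hg
  set M := 2 ^ (L0 + 2 ^ m * 2 ^ m * q) with hM
  have hNM : N ≤ M := hNL.trans (Nat.pow_le_pow_right (by norm_num) (by omega))
  have hdw : ∀ (a : ℝ) (k s : ℕ) (p : ℝ × ℝ), a * walsh k p.1 * walsh s p.2 = a * dw (k, s) p :=
    fun a k s p => by simp [dw, mul_assoc]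
  have hrect : ∀ (a b : ℕ) (p : ℝ × ℝ), ∑ k ∈ Finset.Icc N a, ∑ s ∈ Finset.Icc N b,
      coef m q L0 g (k, s) * walsh k p.1 * walsh s p.2 =
      ∑ k ∈ Finset.Icc N a ×ˢ Finset.Icc N b, coef m q L0 g k * dw k p := by
    intro a b p
    rw [Finset.sum_product]
    simp_rw [hdw]
  refine ⟨EE m q L0, M, fun k s => coef m q L0 g (k, s), measurableSet_EE m q L0, ?_, hNM,
    ?_, ?_, ?_, ?_⟩
  · intro p hp
    exact ⟨⟨hp.1.1.1, hp.1.1.2.le⟩, ⟨hp.1.2.1, hp.1.2.2.le⟩⟩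
  · have hv := volume_EE m q L0 hm
    have hfin : volume (EE m q L0) ≠ ⊤ :=
      ne_top_of_le_ne_top (b := volume TT) (by rw [volume_TT]; simp)
        (measure_mono fun p hp => hp.1)
    have q1 := hq.trans_le (min_le_left ε 1)
    have q2 := hq.trans_le (min_le_right ε 1)
    rw [gt_iff_lt, ← ofReal_measureReal hfin, ENNReal.ofReal_lt_ofReal_iff (by linarith)]
    linarith
  · have := coef_pow m q L0 hm g G (fun ν => hG _) ε hε0 (Finset.Icc N M ×ˢ Finset.Icc N M)
    rw [Finset.sum_product] at this
    exact this.trans_lt hm2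
  · intro p hp
    rw [hrect]
    have hfull : ∀ ν ∈ Finset.range (2 ^ m * 2 ^ m),
        ∑ k ∈ Finset.Icc N M ×ˢ Finset.Icc N M, bterm m q L0 g ν k * dw k p =
        if ν = cellIdx m p then g ν else 0 := by
      intro ν hν
      rw [Finset.mem_range] at hν
      refine full_block m q L0 hm g ν hν _ ?_ p hp
      intro k hk
      have a1 : 2 ^ L0 ≤ 2 ^ (L0 + ν * q) := Nat.pow_le_pow_right (by norm_num) (by omega)
      have a2 : 2 ^ (L0 + ν * q + q) ≤ M := by
        refine Nat.pow_le_pow_right (by norm_num) ?_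
        have : (ν + 1) * q ≤ 2 ^ m * 2 ^ m * q := Nat.mul_le_mul_right _ hν
        nlinarith
      obtain ⟨⟨b1, b2⟩, b3, b4⟩ := hk
      simp only [Finset.mem_product, Finset.mem_Icc]
      omega
    have hsw : ∑ k ∈ Finset.Icc N M ×ˢ Finset.Icc N M, coef m q L0 g k * dw k p =
        ∑ ν ∈ Finset.range (2 ^ m * 2 ^ m),
          ∑ k ∈ Finset.Icc N M ×ˢ Finset.Icc N M, bterm m q L0 g ν k * dw k p := by
      rw [Finset.sum_comm]
      refine Finset.sum_congr rfl fun k _ => ?_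
      rw [coef, Finset.sum_mul]
    rw [hsw, Finset.sum_congr rfl hfull, Finset.sum_ite_eq', if_pos
      (Finset.mem_range.2 (cellIdx_lt m p hp.1))]
    exact stepF_const ν0 γ m1 m2 j1 j2 m q L0 hm h1 h2 p hp
  · intro e he hem nb hnb mb hmb R hR1 hR2
    have r1 := partial_int ν0 γ m1 m2 j1 j2 N m q L0 hm hNL h1 h2 G hG (ε / 2) (half_pos hε0) hm1
      (Finset.Icc N nb ×ˢ Finset.Icc N mb) (by
        intro k hk k' a b c d
        simp only [Finset.mem_product, Finset.mem_Icc] at hk ⊢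
        omega) e he hem
    have r2 := partial_int ν0 γ m1 m2 j1 j2 N m q L0 hm hNL h1 h2 G hG (ε / 2) (half_pos hε0) hm1
      ((Finset.Icc N M ×ˢ Finset.Icc N M).filter
            (fun ks => 2 * N ^ 2 ≤ ks.1 ^ 2 + ks.2 ^ 2 ∧
              ((ks.1 ^ 2 + ks.2 ^ 2 : ℕ) : ℝ) ≤ R ^ 2)) (by
        intro k hk k' a b c d
        simp only [Finset.mem_filter, Finset.mem_product, Finset.mem_Icc] at hk ⊢
        have e1 := Nat.pow_le_pow_left a 2
        have e2 := Nat.pow_le_pow_left b 2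
        have e3 := Nat.pow_le_pow_left c 2
        have e4 := Nat.pow_le_pow_left d 2
        refine ⟨by omega, by omega, le_trans ?_ hk.2.2⟩
        exact_mod_cast Nat.add_le_add e3 e4) e he hem
    simp_rw [hrect]
    simp_rw [hdw]
    refine (add_le_add r1 r2).trans (le_of_eq ?_)
    unfold stepF
    ring
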